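/- Let f : ℂ → ℂ, let τ₀ ∈ ℝ, and suppose f has a complex derivative at τ₀ (in the sense HasDerivAt) whose value f′(τ₀) is a negative real number, and that f(τ₀) is real (Im f(τ₀) = 0). Then there exists γ₀ > 0 such that for all γ with 0 < γ < γ₀ one has Im f(τ₀ − i·γ) > 0. -/

import Mathlib

/-- If `f : ℂ → ℂ` has a complex derivative at a real point `τ₀` whose value is a negative
real number, and `f(τ₀)` is real, then `f(τ₀ - iγ)` has positive imaginary part for all
sufficiently small `γ > 0`. -/
theorem im_pos_of_deriv_neg_real
    (f : ℂ → ℂ) (τ₀ : ℝ) (d : ℝ) (hd : d < 0)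
    (hderiv : HasDerivAt f (d : ℂ) (τ₀ : ℂ))
    (him : (f (τ₀ : ℂ)).im = 0) :
    ∃ γ₀ > (0 : ℝ), ∀ γ : ℝ, 0 < γ → γ < γ₀ →
      0 < (f ((τ₀ : ℂ) - Complex.I * (γ : ℂ))).im := by
  have hc : 0 < -d / 2 := by linarith
  obtain ⟨γ₀, hγ₀, hbound⟩ :=
    Metric.eventually_nhds_iff.1 ((hasDerivAt_iff_isLittleO.1 hderiv).def hc)
  refine ⟨γ₀, hγ₀, fun γ hγ hlt => ?_⟩
  have hsub : (τ₀ : ℂ) - Complex.I * γ - τ₀ = -(Complex.I * γ) := by ring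
  have hnorm : ‖(τ₀ : ℂ) - Complex.I * γ - τ₀‖ = γ := by
    simp [hsub, abs_of_pos hγ]
  have hle := hbound (y := (τ₀ : ℂ) - Complex.I * γ) (by rwa [dist_eq_norm, hnorm])
  rw [hnorm, hsub] at hle
  have him_le := (abs_le.1 ((Complex.abs_im_le_norm _).trans hle)).1
  simp [him] at him_le
  nlinarith [mul_pos hγ hc]
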